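/- (Homogeneity of the forcing.) Suppose ζ is an initial segment of I and X, Y ∈ Pe(ζ). There exists a homeomorphism F : X → Y such that: (1) for every initial segment ξ ⊆ ζ and all x, y ∈ X, x↾ξ = y↾ξ if and only if F(x)↾ξ = F(y)↾ξ; (2) if ξ ⊆ ζ is an initial segment and X↾ξ = Y↾ξ, then x↾ξ = F(x)↾ξ for all x ∈ X; (3) for each X' ⊆ X, X' ∈ Pe(ζ) if and only if the image F''X' = {F(x) : x ∈ X'} belongs to Pe(ζ). -/

import Mathlib

open Set

abbrev Cantor : Type := ℕ → Bool

section
variable {I : Type}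

/-- Restriction of a point of `D^η` to `D^ξ` (for `ξ ⊆ η`). -/
def restrictFn {ξ η : Set I} (h : ξ ⊆ η) (x : ↥η → Cantor) : ↥ξ → Cantor :=
  fun j => x ⟨j.1, h j.2⟩

/-- Projection `X↾ξ` of a set `X ⊆ D^η`. -/
def resSet {ξ η : Set I} (h : ξ ⊆ η) (X : Set (↥η → Cantor)) : Set (↥ξ → Cantor) :=
  restrictFn h '' X

/-- Inverse projection `Y↾⁻¹η` of a set `Y ⊆ D^ξ`. -/
def resPre {ξ η : Set I} (h : ξ ⊆ η) (Y : Set (↥ξ → Cantor)) : Set (↥η → Cantor) :=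
  {y | restrictFn h y ∈ Y}

/-- `A` is (relatively) open in `B`. -/
def RelOpen {α : Type*} [TopologicalSpace α] (A B : Set α) : Prop :=
  ∃ U, IsOpen U ∧ A = U ∩ B

/-- `A` is (relatively) closed in `B`. -/
def RelClosed {α : Type*} [TopologicalSpace α] (A B : Set α) : Prop :=
  ∃ U, IsClosed U ∧ A = U ∩ B

/-- `A` is (relatively) clopen in `B`. -/
def RelClopen {α : Type*} [TopologicalSpace α] (A B : Set α) : Prop :=
  RelOpen A B ∧ RelClosed A B

open Classical in
/-- The union `x ∪ y` of two partial points agreeing on the common domain. -/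
noncomputable def glue {ξ η : Set I} (x : ↥ξ → Cantor) (y : ↥η → Cantor) :
    ↥(ξ ∪ η) → Cantor :=
  fun j => if h : j.1 ∈ ξ then x ⟨j.1, h⟩
           else y ⟨j.1, ((Set.mem_union j.1 ξ η).mp j.2).resolve_left h⟩

variable [PartialOrder I]

/-- `[<i]`. -/
def seg (i : I) : Set I := {j | j < i}

/-- `[≤i]`. -/
def segLe (i : I) : Set I := {j | j ≤ i}

/-- `[≯i]`. -/
def segNG (i : I) : Set I := {j | ¬ i < j}

lemma seg_subset {ζ : Set I} (hζ : IsLowerSet ζ) {i : I} (hi : i ∈ ζ) : seg i ⊆ ζ :=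
  fun _ hj => hζ (le_of_lt hj) hi

lemma segLe_subset {ζ : Set I} (hζ : IsLowerSet ζ) {i : I} (hi : i ∈ ζ) : segLe i ⊆ ζ :=
  fun _ hj => hζ hj hi

lemma isLowerSet_segLe (i : I) : IsLowerSet (segLe i) :=
  fun _ _ hba ha => le_trans hba ha

lemma seg_subset_segLe (i : I) : seg i ⊆ segLe i :=
  fun _ hj => le_of_lt hj

lemma mem_segLe_self (i : I) : i ∈ segLe i := le_refl i

/-- `D_{Xz}(i) = {x(i) : x ∈ X, x↾(<i) = z}`. -/
def Dxz {ζ : Set I} (X : Set (↥ζ → Cantor)) {i : I} (hi : i ∈ ζ) (h : seg i ⊆ ζ)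
    (z : ↥(seg i) → Cantor) : Set Cantor :=
  {c | ∃ x ∈ X, restrictFn h x = z ∧ x ⟨i, hi⟩ = c}

/-- Pre-conditions `IPe(ζ)`. -/
def IPe (ζ : Set I) (hζ : IsLowerSet ζ) (X : Set (↥ζ → Cantor)) : Prop :=
  -- P-1
  (IsClosed X ∧ X.Nonempty) ∧
  -- P-2
  (∀ (i : I) (hi : i ∈ ζ), ∀ z ∈ resSet (seg_subset hζ hi) X,
      Perfect (Dxz X hi (seg_subset hζ hi) z)) ∧
  -- P-3
  (∀ (i : I) (hi : i ∈ ζ), ∀ G : Set Cantor, IsOpen G →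
      RelOpen
        ({z | ∃ x ∈ X, x ⟨i, hi⟩ ∈ G ∧ restrictFn (seg_subset hζ hi) x = z} :
          Set (↥(seg i) → Cantor))
        (resSet (seg_subset hζ hi) X)) ∧
  -- P-4
  (∀ ξ η : Set I, IsLowerSet ξ → IsLowerSet η → ∀ (hξ : ξ ⊆ ζ) (hη : η ⊆ ζ),
      ∀ x ∈ resSet hξ X, ∀ y ∈ resSet hη X,
        restrictFn (Set.inter_subset_left : ξ ∩ η ⊆ ξ) x =
          restrictFn (Set.inter_subset_right : ξ ∩ η ⊆ η) y →
        glue x y ∈ resSet (Set.union_subset hξ hη) X)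

/-- `stem(A)`: the length of the longest common initial segment of members of `A`. -/
noncomputable def stem (A : Set Cantor) : ℕ :=
  sInf {n | ∃ a ∈ A, ∃ b ∈ A, a n ≠ b n}

/-- `Spl(A,e)` for `A ⊆ D`. -/
def SplD (A : Set Cantor) (e : Bool) : Set Cantor :=
  {a ∈ A | a (stem A) = e}

/-- `Spl(X,i,e)` for `X ⊆ D^ζ`. -/
def Spl {ζ : Set I} (hζ : IsLowerSet ζ) (X : Set (↥ζ → Cantor)) {i : I} (hi : i ∈ ζ)
    (e : Bool) : Set (↥ζ → Cantor) :=
  {x ∈ X |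
    x ⟨i, hi⟩ ∈
      SplD (Dxz X hi (seg_subset hζ hi) (restrictFn (seg_subset hζ hi) x)) e}

/-- A `ζ`-admissible function: `Φ : ω → ζ` taking each value of `ζ` infinitely often. -/
def Admissible (ζ : Set I) (Φ : ℕ → I) : Prop :=
  (∀ n, Φ n ∈ ζ) ∧ ∀ i ∈ ζ, ∀ N : ℕ, ∃ n, N ≤ n ∧ Φ n = i

/-- The sets `X_Φ[u]` for finite binary sequences `u`. -/
def XPhi {ζ : Set I} (hζ : IsLowerSet ζ) (Φ : ℕ → I) (hΦ : ∀ n, Φ n ∈ ζ)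
    (X : Set (↥ζ → Cantor)) : (m : ℕ) → (Fin m → Bool) → Set (↥ζ → Cantor)
  | 0, _ => X
  | m + 1, u =>
      Spl hζ (XPhi hζ Φ hΦ X m (fun k => u k.castSucc)) (hΦ m) (u (Fin.last m))

/-- `X` is shrinkable: each `X_Φ[a]` is a singleton. -/
def Shrinkable {ζ : Set I} (hζ : IsLowerSet ζ) (X : Set (↥ζ → Cantor)) : Prop :=
  ∀ (Φ : ℕ → I) (hΦ : Admissible ζ Φ) (a : ℕ → Bool),
    ∃ x, (⋂ m : ℕ, XPhi hζ Φ hΦ.1 X m (fun k => a k.1)) = {x}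

/-- Conditions `Pe(ζ)`: shrinkable pre-conditions. -/
def Pe (ζ : Set I) (hζ : IsLowerSet ζ) (X : Set (↥ζ → Cantor)) : Prop :=
  IPe ζ hζ X ∧ Shrinkable hζ X

/-- `Perf = Pe(I)`. -/
def Perf (X : Set (↥(Set.univ : Set I) → Cantor)) : Prop :=
  Pe Set.univ isLowerSet_univ X

/-- The initial segments `ξ[u,v]`. -/
def xiUV (Φ : ℕ → I) : (m : ℕ) → (Fin m → Bool) → (Fin m → Bool) → Set I
  | 0, _, _ => Set.univ
  | m + 1, u, v =>
      if u (Fin.last m) = v (Fin.last m) then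
        xiUV Φ m (fun k => u k.castSucc) (fun k => v k.castSucc)
      else
        xiUV Φ m (fun k => u k.castSucc) (fun k => v k.castSucc) ∩ segNG (Φ m)

/-- A `Φ`-splitting system of order `m`. -/
def SplittingSystem (Φ : ℕ → I) (m : ℕ)
    (X : (n : ℕ) → (Fin n → Bool) → Set (↥(Set.univ : Set I) → Cantor)) : Prop :=
  (∀ n, n ≤ m → ∀ u : Fin n → Bool, Perf (X n u)) ∧
  -- S-1
  (∀ n, n < m → ∀ (u : Fin n → Bool) (e : Bool),
      X (n + 1) (Fin.snoc u e) ⊆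
        Spl isLowerSet_univ (X n u) (Set.mem_univ (Φ n)) e) ∧
  -- S-2
  (∀ n, n ≤ m → ∀ u v : Fin n → Bool,
      resSet (Set.subset_univ (xiUV Φ n u v)) (X n u) =
        resSet (Set.subset_univ (xiUV Φ n u v)) (X n v)) ∧
  -- S-3
  (∀ n, n ≤ m → ∀ u v : Fin n → Bool, ∀ i : I, i ∉ xiUV Φ n u v →
      resSet (Set.subset_univ (segLe i)) (X n u) ∩
        resSet (Set.subset_univ (segLe i)) (X n v) = ∅)

/-- `F` is reducible to `ξ` on `X`. -/
def Reducible {β : Type*} (F : (↥(Set.univ : Set I) → Cantor) → β) (ξ : Set I)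
    (X : Set (↥(Set.univ : Set I) → Cantor)) : Prop :=
  ∀ x ∈ X, ∀ y ∈ X,
    restrictFn (Set.subset_univ ξ) x = restrictFn (Set.subset_univ ξ) y → F x = F y

/-- `F` captures `i` on `X`. -/
def Captures {β : Type*} (F : (↥(Set.univ : Set I) → Cantor) → β) (i : I)
    (X : Set (↥(Set.univ : Set I) → Cantor)) : Prop :=
  ∀ x ∈ X, ∀ y ∈ X, F x = F y → x ⟨i, Set.mem_univ i⟩ = y ⟨i, Set.mem_univ i⟩

/-- Borel sets of finite level: level `0` = closed sets, level `n+1` = countable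
unions or countable intersections of sets of level `n`. -/
def BorelLevel {α : Type*} [TopologicalSpace α] : ℕ → Set (Set α)
  | 0 => {C | IsClosed C}
  | n + 1 =>
      {S | (∃ f : ℕ → Set α, (∀ k, f k ∈ BorelLevel n) ∧ S = ⋃ k, f k) ∨
           (∃ f : ℕ → Set α, (∀ k, f k ∈ BorelLevel n) ∧ S = ⋂ k, f k)}

end

open Filter Topology

section Homogeneity

variable {I : Type} {ζ : Set I}

/-- Two points of `D^ζ` agree on the coordinates in `ξ`. -/
abbrev AgreeOn (ξ : Set I) (x y : ↥ζ → Cantor) : Prop :=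
  Set.EqOn x y (Subtype.val ⁻¹' ξ)

lemma restrictFn_eq_iff_agreeOn {ξ : Set I} (h : ξ ⊆ ζ) {x y : ↥ζ → Cantor} :
    restrictFn h x = restrictFn h y ↔ AgreeOn ξ x y :=
  ⟨fun e j hj => congrFun e ⟨j.1, hj⟩, fun e => funext fun j => e (x := ⟨j.1, h j.2⟩) j.2⟩

lemma continuous_restrictFn {ξ : Set I} (h : ξ ⊆ ζ) :
    Continuous (restrictFn h : (↥ζ → Cantor) → ↥ξ → Cantor) :=
  continuous_pi fun _ => continuous_apply _

lemma AgreeOn.mono {ξ η : Set I} {x y : ↥ζ → Cantor} (h : AgreeOn ξ x y) (hηξ : η ⊆ ξ) :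
    AgreeOn η x y :=
  Set.EqOn.mono (Set.preimage_mono hηξ) h

lemma isClosed_setOf_agreeOn {α : Type*} [TopologicalSpace α] {f g : α → ↥ζ → Cantor}
    (hf : Continuous f) (hg : Continuous g) (ξ : Set I) :
    IsClosed {a | AgreeOn ξ (f a) (g a)} := by
  simp only [AgreeOn, Set.EqOn, Set.ofPred_forall]
  exact isClosed_iInter fun j => isClosed_iInter fun _ =>
    isClosed_eq ((continuous_apply j).comp hf) ((continuous_apply j).comp hg)

/-- `X` and `Y` have the same projection to the coordinates in `ξ`. -/
def SameProj (ξ : Set I) (X Y : Set (↥ζ → Cantor)) : Prop :=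
  (∀ x ∈ X, ∃ y ∈ Y, AgreeOn ξ y x) ∧ ∀ y ∈ Y, ∃ x ∈ X, AgreeOn ξ x y

lemma SameProj.symm {ξ : Set I} {X Y : Set (↥ζ → Cantor)} (h : SameProj ξ X Y) :
    SameProj ξ Y X :=
  ⟨h.2, h.1⟩

lemma SameProj.refl (ξ : Set I) (X : Set (↥ζ → Cantor)) : SameProj ξ X X :=
  ⟨fun x hx => ⟨x, hx, fun _ _ => rfl⟩, fun x hx => ⟨x, hx, fun _ _ => rfl⟩⟩

lemma SameProj.of_resSet_eq {ξ : Set I} (h : ξ ⊆ ζ) {X Y : Set (↥ζ → Cantor)}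
    (hXY : resSet h X = resSet h Y) : SameProj ξ X Y := by
  constructor
  · intro x hx
    obtain ⟨y, hy, hyx⟩ : restrictFn h x ∈ resSet h Y :=
      hXY ▸ (Set.mem_image_of_mem _ hx : _ ∈ resSet h X)
    exact ⟨y, hy, (restrictFn_eq_iff_agreeOn h).1 hyx⟩
  · intro y hy
    obtain ⟨x, hx, hxy⟩ : restrictFn h y ∈ resSet h X :=
      hXY ▸ (Set.mem_image_of_mem _ hy : _ ∈ resSet h Y)
    exact ⟨x, hx, (restrictFn_eq_iff_agreeOn h).1 hxy⟩

lemma setOf_apply_eq_mem_nhds {c : Cantor} {n : ℕ} {e : Bool} (h : c n = e) :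
    {d : Cantor | d n = e} ∈ 𝓝 c :=
  (continuous_apply n).continuousAt.preimage_mem_nhds
    ((isOpen_discrete {b : Bool | b = e}).mem_nhds h)

section Image

variable {X Y : Set (↥ζ → Cantor)}

/-- The image of a subset of `X` under a map `X → Y`, as a set of points of `D^ζ`. -/
def imageOn (F : ↥X → ↥Y) (S : Set (↥ζ → Cantor)) : Set (↥ζ → Cantor) :=
  {y | ∃ x : ↥X, x.1 ∈ S ∧ (F x).1 = y}

lemma mem_imageOn {F : ↥X ≃ₜ ↥Y} {S : Set (↥ζ → Cantor)} {x : ↥X} :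
    (F x).1 ∈ imageOn F S ↔ x.1 ∈ S := by
  constructor
  · rintro ⟨x', hx', h⟩
    obtain rfl := F.injective (Subtype.ext h)
    exact hx'
  · exact fun h => ⟨x, h, rfl⟩

lemma imageOn_subset (F : ↥X → ↥Y) (S : Set (↥ζ → Cantor)) : imageOn F S ⊆ Y := by
  rintro _ ⟨x, -, rfl⟩
  exact (F x).2

lemma imageOn_symm_imageOn (F : ↥X ≃ₜ ↥Y) {S : Set (↥ζ → Cantor)} (hS : S ⊆ X) :
    imageOn F.symm (imageOn F S) = S := by
  ext x
  constructor
  · rintro ⟨y, hy, rfl⟩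
    rw [← F.apply_symm_apply y] at hy
    exact mem_imageOn.1 hy
  · exact fun hx => ⟨F ⟨x, hS hx⟩, ⟨⟨x, hS hx⟩, hx, rfl⟩, by simp⟩

end Image

lemma exists_admissible [Countable I] (hne : ζ.Nonempty) : ∃ Φ : ℕ → I, Admissible ζ Φ := by
  have : Nonempty ζ := hne.to_subtype
  obtain ⟨f, hf⟩ := exists_surjective_nat ζ
  refine ⟨fun n => f n.unpair.1, fun n => (f _).2, fun i hi N => ?_⟩
  obtain ⟨k, hk⟩ := hf ⟨i, hi⟩
  exact ⟨Nat.pair k N, Nat.right_le_pair k N, by simp [hk]⟩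

variable [PartialOrder I]

lemma isLowerSet_seg (i : I) : IsLowerSet (seg i) :=
  fun _ _ hba ha => lt_of_le_of_lt hba ha

/-- The pre-conditions `IPe(ζ)`, phrased through points of `X` instead of projections. -/
structure PreCond (X : Set (↥ζ → Cantor)) : Prop where
  isClosed : IsClosed X
  nonempty : X.Nonempty
  exists_ne : ∀ (i : ζ), ∀ x ∈ X, ∀ U ∈ 𝓝 (x i),
    ∃ y ∈ X, AgreeOn (seg i.1) y x ∧ y i ∈ U ∧ y i ≠ x i
  eventually : ∀ (i : ζ), ∀ x ∈ X, ∀ y ∈ X, AgreeOn (seg i.1) y x → ∀ G ∈ 𝓝 (y i),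
    ∀ᶠ x' in 𝓝[X] x, ∃ y' ∈ X, AgreeOn (seg i.1) y' x' ∧ y' i ∈ G
  amalgamation : ∀ ξ η : Set I, IsLowerSet ξ → IsLowerSet η → ∀ x ∈ X, ∀ y ∈ X,
    AgreeOn (ξ ∩ η) x y → ∃ w ∈ X, AgreeOn ξ w x ∧ AgreeOn η w y

lemma IPe.preCond {hζ : IsLowerSet ζ} {X : Set (↥ζ → Cantor)} (h : IPe ζ hζ X) :
    PreCond X := by
  obtain ⟨⟨hcl, hne⟩, hperf, hopen, hamal⟩ := h
  refine ⟨hcl, hne, ?_, ?_, ?_⟩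
  · intro i x hx U hU
    have hacc := (hperf i.1 i.2 _ (Set.mem_image_of_mem _ hx)).acc (x i) ⟨x, hx, rfl, rfl⟩
    rw [accPt_iff_nhds] at hacc
    obtain ⟨c, ⟨hcU, y, hy, hyx, rfl⟩, hne⟩ := hacc U hU
    exact ⟨y, hy, (restrictFn_eq_iff_agreeOn _).1 hyx, hcU, hne⟩
  · intro i x hx y hy hyx G hG
    obtain ⟨G', hG'G, hG', hyG'⟩ := mem_nhds_iff.1 hG
    obtain ⟨U, hU, hUeq⟩ := hopen i.1 i.2 G' hG'
    have hxU : restrictFn (seg_subset hζ i.2) x ∈ U := by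
      have : restrictFn (seg_subset hζ i.2) x ∈ U ∩ resSet (seg_subset hζ i.2) X := by
        rw [← hUeq]
        exact ⟨y, hy, hyG', (restrictFn_eq_iff_agreeOn _).2 hyx⟩
      exact this.1
    have hnhds : ∀ᶠ x' in 𝓝[X] x, restrictFn (seg_subset hζ i.2) x' ∈ U :=
      ((continuous_restrictFn _).continuousAt.eventually (hU.mem_nhds hxU)).filter_mono
        nhdsWithin_le_nhds
    filter_upwards [hnhds, self_mem_nhdsWithin] with x' hx'U hx'
    have : restrictFn (seg_subset hζ i.2) x' ∈ U ∩ resSet (seg_subset hζ i.2) X :=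
      ⟨hx'U, Set.mem_image_of_mem _ hx'⟩
    rw [← hUeq] at this
    obtain ⟨y', hy', hy'G, hy'x'⟩ := this
    exact ⟨y', hy', (restrictFn_eq_iff_agreeOn _).1 hy'x', hG'G hy'G⟩
  · intro ξ η hξ hη x hx y hy hxy
    obtain ⟨w, hw, hweq⟩ := hamal (ξ ∩ ζ) (η ∩ ζ) (hξ.inter hζ) (hη.inter hζ)
      Set.inter_subset_right Set.inter_subset_right _ (Set.mem_image_of_mem _ hx)
      _ (Set.mem_image_of_mem _ hy)
      (funext fun j => hxy (x := ⟨j.1, j.2.1.2⟩) ⟨j.2.1.1, j.2.2.1⟩)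
    refine ⟨w, hw, fun j hj => ?_, fun j hj => ?_⟩
    · have := congrFun hweq ⟨j.1, Or.inl ⟨hj, j.2⟩⟩
      have hj' : j.1 ∈ ξ ∩ ζ := ⟨hj, j.2⟩
      simpa [glue, restrictFn, hj'] using this
    · have := congrFun hweq ⟨j.1, Or.inr ⟨hj, j.2⟩⟩
      by_cases hjξ : j.1 ∈ ξ
      · have hj' : j.1 ∈ ξ ∩ ζ := ⟨hjξ, j.2⟩
        have h1 : w j = x j := by simpa [glue, restrictFn, hj'] using this
        exact h1.trans (hxy ⟨hjξ, hj⟩)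
      · have hj' : j.1 ∉ ξ ∩ ζ := fun h => hjξ h.1
        simpa [glue, restrictFn, hj', hjξ] using this

lemma PreCond.iPe (hζ : IsLowerSet ζ) {X : Set (↥ζ → Cantor)} (h : PreCond X) :
    IPe ζ hζ X := by
  refine ⟨⟨h.isClosed, h.nonempty⟩, ?_, ?_, ?_⟩
  · rintro i hi _ ⟨x, hx, rfl⟩
    refine ⟨?_, ?_⟩
    · have hK : IsCompact (X ∩ {y | AgreeOn (seg i) y x}) :=
        (h.isClosed.inter
          (isClosed_setOf_agreeOn continuous_id continuous_const _)).isCompact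
      convert (hK.image (continuous_apply (⟨i, hi⟩ : ζ))).isClosed using 1
      ext c
      simp only [Dxz, restrictFn_eq_iff_agreeOn, Set.mem_ofPred_eq, Set.mem_image,
        Set.mem_inter_iff, and_assoc]
    · rintro _ ⟨x', hx', hx'x, rfl⟩
      rw [accPt_iff_nhds]
      intro U hU
      obtain ⟨y, hy, hyx, hyU, hne⟩ := h.exists_ne ⟨i, hi⟩ x' hx' U hU
      exact ⟨_, ⟨hyU, y, hy, ((restrictFn_eq_iff_agreeOn _).2 hyx).trans hx'x, rfl⟩, hne⟩
  · intro i hi G hG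
    let r := restrictFn (seg_subset hζ hi)
    let W := {x ∈ X | ∃ y ∈ X, AgreeOn (seg i) y x ∧ y ⟨i, hi⟩ ∈ G}
    have hC : IsClosed (X \ W) := by
      rw [← isOpen_compl_iff, isOpen_iff_mem_nhds]
      intro x hx
      by_cases hxX : x ∈ X
      · have hxW : x ∈ W := by
          by_contra hxW
          exact hx ⟨hxX, hxW⟩
        obtain ⟨-, y, hy, hyx, hyG⟩ := hxW
        have := h.eventually ⟨i, hi⟩ x hxX y hy hyx G (hG.mem_nhds hyG)
        filter_upwards [eventually_nhdsWithin_iff.1 this] with x' hx' hmem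
        exact hmem.2 ⟨hmem.1, hx' hmem.1⟩
      · filter_upwards [h.isClosed.isOpen_compl.mem_nhds hxX] with x' hx' hmem
        exact hx' hmem.1
    refine ⟨(r '' (X \ W))ᶜ,
      ((hC.isCompact.image (continuous_restrictFn _)).isClosed).isOpen_compl, ?_⟩
    ext z
    constructor
    · rintro ⟨y, hy, hyG, rfl⟩
      refine ⟨?_, Set.mem_image_of_mem _ hy⟩
      rintro ⟨x, ⟨hx, hxW⟩, hxy⟩
      exact hxW ⟨hx, y, hy, ((restrictFn_eq_iff_agreeOn _).1 hxy).symm, hyG⟩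
    · rintro ⟨hz, x, hx, rfl⟩
      have hxW : x ∈ W := by
        by_contra hxW
        exact hz ⟨x, ⟨hx, hxW⟩, rfl⟩
      obtain ⟨-, y, hy, hyx, hyG⟩ := hxW
      exact ⟨y, hy, hyG, (restrictFn_eq_iff_agreeOn _).2 hyx⟩
  · rintro ξ η hξ hη hξζ hηζ _ ⟨x, hx, rfl⟩ _ ⟨y, hy, rfl⟩ hxy
    obtain ⟨w, hw, hwx, hwy⟩ := h.amalgamation ξ η hξ hη x hx y hy
      fun j hj => congrFun hxy ⟨j.1, hj⟩
    refine ⟨w, hw, funext fun j => ?_⟩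
    by_cases hj : j.1 ∈ ξ
    · simpa [glue, restrictFn, hj] using hwx (x := ⟨j.1, hξζ hj⟩) hj
    · have hj' := j.2.resolve_left hj
      simpa [glue, restrictFn, hj] using hwy (x := ⟨j.1, hηζ hj'⟩) hj'

/-- The stem of the section `D_{Xz}(i)`, where `z` is the restriction of `x` to `[<i]`. -/
noncomputable def splitLevel (X : Set (↥ζ → Cantor)) (i : ζ) (x : ↥ζ → Cantor) : ℕ :=
  sInf {n | ∃ y ∈ X, ∃ z ∈ X,
    AgreeOn (seg i.1) y x ∧ AgreeOn (seg i.1) z x ∧ y i n ≠ z i n}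

/-- `Spl(X,i,e)`, phrased through `splitLevel`. -/
def split (X : Set (↥ζ → Cantor)) (i : ζ) (e : Bool) : Set (↥ζ → Cantor) :=
  {x ∈ X | x i (splitLevel X i x) = e}

/-- The sets `X_Φ[a↾m]`, phrased through `split`. -/
def splitSeq (Φ : ℕ → ζ) (X : Set (↥ζ → Cantor)) (a : ℕ → Bool) :
    ℕ → Set (↥ζ → Cantor)
  | 0 => X
  | m + 1 => split (splitSeq Φ X a m) (Φ m) (a m)

lemma Spl_eq_split (hζ : IsLowerSet ζ) (X : Set (↥ζ → Cantor)) {i : I} (hi : i ∈ ζ)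
    (e : Bool) : Spl hζ X hi e = split X ⟨i, hi⟩ e := by
  ext x
  have hlevel : stem (Dxz X hi (seg_subset hζ hi) (restrictFn (seg_subset hζ hi) x)) =
      splitLevel X ⟨i, hi⟩ x := by
    unfold stem splitLevel
    congr 1
    ext n
    simp only [Dxz, restrictFn_eq_iff_agreeOn, Set.mem_ofPred_eq]
    constructor
    · rintro ⟨_, ⟨y, hy, hyx, rfl⟩, _, ⟨z, hz, hzx, rfl⟩, hne⟩
      exact ⟨y, hy, z, hz, hyx, hzx, hne⟩
    · rintro ⟨y, hy, z, hz, hyx, hzx, hne⟩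
      exact ⟨_, ⟨y, hy, hyx, rfl⟩, _, ⟨z, hz, hzx, rfl⟩, hne⟩
  simp only [Spl, SplD, split, Set.mem_ofPred_eq, hlevel]
  exact ⟨fun h => ⟨h.1, h.2.2⟩, fun h => ⟨h.1, ⟨x, h.1, rfl, rfl⟩, h.2⟩⟩

lemma XPhi_eq_splitSeq (hζ : IsLowerSet ζ) (Φ : ℕ → I) (hΦ : ∀ n, Φ n ∈ ζ)
    (X : Set (↥ζ → Cantor)) (a : ℕ → Bool) (m : ℕ) :
    XPhi hζ Φ hΦ X m (fun k => a k.1) = splitSeq (fun n => ⟨Φ n, hΦ n⟩) X a m := by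
  induction m with
  | zero => rfl
  | succ m ih =>
    rw [XPhi, Spl_eq_split, splitSeq, ← ih]
    rfl

section Split

variable {X Y : Set (↥ζ → Cantor)} {i : ζ} {x y z : ↥ζ → Cantor}

lemma eq_of_lt_splitLevel {n : ℕ} (hn : n < splitLevel X i x) (hy : y ∈ X) (hz : z ∈ X)
    (hyx : AgreeOn (seg i.1) y x) (hzx : AgreeOn (seg i.1) z x) : y i n = z i n := by
  by_contra hne
  exact Nat.notMem_of_lt_sInf hn ⟨y, hy, z, hz, hyx, hzx, hne⟩

lemma splitLevel_eq_of_forall {n : ℕ} (hy : y ∈ X) (hz : z ∈ X)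
    (hyx : AgreeOn (seg i.1) y x) (hzx : AgreeOn (seg i.1) z x) (hne : y i n ≠ z i n)
    (h : ∀ k < n, ∀ w ∈ X, AgreeOn (seg i.1) w x → w i k = x i k) :
    splitLevel X i x = n := by
  refine le_antisymm (Nat.sInf_le ⟨y, hy, z, hz, hyx, hzx, hne⟩)
    (le_csInf ⟨n, y, hy, z, hz, hyx, hzx, hne⟩ ?_)
  rintro k ⟨v, hv, w, hw, hvx, hwx, hk⟩
  by_contra! hkn
  exact hk ((h k hkn v hv hvx).trans (h k hkn w hw hwx).symm)

lemma PreCond.exists_ne_splitLevel (hX : PreCond X) (i : ζ) (hx : x ∈ X) :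
    ∃ y ∈ X, ∃ z ∈ X, AgreeOn (seg i.1) y x ∧ AgreeOn (seg i.1) z x ∧
      y i (splitLevel X i x) ≠ z i (splitLevel X i x) := by
  obtain ⟨y, hy, hyx, -, hne⟩ := hX.exists_ne i x hx Set.univ univ_mem
  obtain ⟨n, hn⟩ := Function.ne_iff.1 hne
  exact Nat.sInf_mem (s := {n | ∃ y ∈ X, ∃ z ∈ X,
    AgreeOn (seg i.1) y x ∧ AgreeOn (seg i.1) z x ∧ y i n ≠ z i n})
    ⟨n, y, hy, x, hx, hyx, fun _ _ => rfl, hn⟩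

lemma exists_agreeOn_segLe {ξ : Set I} (hξ : IsLowerSet ξ) (hi : i.1 ∈ ξ)
    (h : SameProj ξ X Y) (hx : x ∈ X) : ∃ y ∈ Y, AgreeOn (segLe i.1) y x := by
  obtain ⟨y, hy, hyx⟩ := h.1 x hx
  exact ⟨y, hy, hyx.mono (segLe_subset hξ hi)⟩

lemma splitLevel_congr {ξ : Set I} (hξ : IsLowerSet ξ) (hi : i.1 ∈ ξ)
    (h : SameProj ξ X Y) (hyx : AgreeOn (seg i.1) y x) :
    splitLevel X i x = splitLevel Y i y := by
  have aux : ∀ {X Y : Set (↥ζ → Cantor)} {x y : ↥ζ → Cantor}, SameProj ξ X Y →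
      AgreeOn (seg i.1) y x → ∀ n,
      (∃ v ∈ X, ∃ w ∈ X, AgreeOn (seg i.1) v x ∧ AgreeOn (seg i.1) w x ∧ v i n ≠ w i n) →
      ∃ v ∈ Y, ∃ w ∈ Y, AgreeOn (seg i.1) v y ∧ AgreeOn (seg i.1) w y ∧ v i n ≠ w i n := by
    rintro X Y x y h hyx n ⟨v, hv, w, hw, hvx, hwx, hne⟩
    obtain ⟨v', hv', hvv'⟩ := exists_agreeOn_segLe hξ hi h hv
    obtain ⟨w', hw', hww'⟩ := exists_agreeOn_segLe hξ hi h hw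
    refine ⟨v', hv', w', hw', ((hvv'.mono (seg_subset_segLe _)).trans hvx).trans hyx.symm,
      ((hww'.mono (seg_subset_segLe _)).trans hwx).trans hyx.symm, ?_⟩
    rwa [hvv' (mem_segLe_self i.1), hww' (mem_segLe_self i.1)]
  unfold splitLevel
  congr 1
  ext n
  exact ⟨aux h hyx n, aux h.symm hyx.symm n⟩

lemma splitLevel_congr_point (h : AgreeOn (seg i.1) y x) :
    splitLevel X i x = splitLevel X i y :=
  splitLevel_congr (isLowerSet_segLe i.1) (mem_segLe_self i.1) (SameProj.refl _ X) h

lemma split_subset (X : Set (↥ζ → Cantor)) (i : ζ) (e : Bool) : split X i e ⊆ X :=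
  fun _ hx => hx.1

lemma mem_split_of_agreeOn {e : Bool} (hx : x ∈ split X i e) (hy : y ∈ X)
    (hyx : AgreeOn (segLe i.1) y x) : y ∈ split X i e := by
  refine ⟨hy, ?_⟩
  rw [hyx (mem_segLe_self i.1),
    ← splitLevel_congr_point (hyx.mono (seg_subset_segLe i.1))]
  exact hx.2

lemma PreCond.exists_mem_split (hX : PreCond X) (i : ζ) (e : Bool) (hx : x ∈ X) :
    ∃ y ∈ split X i e, AgreeOn (seg i.1) y x := by
  obtain ⟨y, hy, z, hz, hyx, hzx, hne⟩ := hX.exists_ne_splitLevel i hx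
  by_cases he : y i (splitLevel X i x) = e
  · exact ⟨y, ⟨hy, by rwa [← splitLevel_congr_point hyx]⟩, hyx⟩
  · refine ⟨z, ⟨hz, ?_⟩, hzx⟩
    rw [← splitLevel_congr_point hzx]
    cases e <;> simp_all

lemma PreCond.exists_mem_split_agreeOn (hX : PreCond X) (e : Bool) {ξ : Set I}
    (hξ : IsLowerSet ξ) (hi : i.1 ∉ ξ) (hx : x ∈ X) :
    ∃ y ∈ split X i e, AgreeOn ξ y x := by
  obtain ⟨y, hy, hyx⟩ := hX.exists_mem_split i e hx
  obtain ⟨w, hw, hwx, hwy⟩ := hX.amalgamation ξ (segLe i.1) hξ (isLowerSet_segLe _)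
    x hx y hy.1 (hyx.symm.mono fun j hj => lt_of_le_of_ne hj.2 fun h => hi (h ▸ hj.1))
  exact ⟨w, mem_split_of_agreeOn hy hw hwy, hwx⟩

lemma PreCond.eventually_splitLevel_eq (hX : PreCond X) (i : ζ) (hx : x ∈ X) :
    ∀ᶠ x' in 𝓝[X] x, splitLevel X i x' = splitLevel X i x := by
  obtain ⟨y, hy, z, hz, hyx, hzx, hne⟩ := hX.exists_ne_splitLevel i hx
  set s := splitLevel X i x with hs
  have hlow : ∀ᶠ x' in 𝓝 x, ∀ k ∈ Finset.range s,
      ∀ w ∈ X, x' ∈ X → AgreeOn (seg i.1) w x' → w i k = x' i k := by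
    rw [Filter.eventually_all_finset]
    intro k hk
    have hK : IsClosed {p : (↥ζ → Cantor) × (↥ζ → Cantor) |
        p.2 ∈ X ∧ p.1 ∈ X ∧ AgreeOn (seg i.1) p.2 p.1 ∧ p.2 i k ≠ p.1 i k} := by
      refine (hX.isClosed.preimage continuous_snd).inter
        ((hX.isClosed.preimage continuous_fst).inter
          ((isClosed_setOf_agreeOn continuous_snd continuous_fst _).inter ?_))
      exact (isClosed_discrete {b : Bool × Bool | b.1 ≠ b.2}).preimage
        (f := fun p : (↥ζ → Cantor) × (↥ζ → Cantor) => (p.2 i k, p.1 i k)) (by fun_prop)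
    have hx' : x ∈ (Prod.fst '' {p : (↥ζ → Cantor) × (↥ζ → Cantor) |
        p.2 ∈ X ∧ p.1 ∈ X ∧ AgreeOn (seg i.1) p.2 p.1 ∧ p.2 i k ≠ p.1 i k})ᶜ := by
      rintro ⟨⟨_, w⟩, ⟨hw, -, hwx, hne'⟩, rfl⟩
      exact hne' (eq_of_lt_splitLevel (Finset.mem_range.1 hk) hw hx hwx fun _ _ => rfl)
    filter_upwards [(isClosedMap_fst_of_compactSpace _ hK).isOpen_compl.mem_nhds hx']
      with x' hx' w hw hx'X hwx'
    by_contra hne'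
    exact hx' ⟨(x', w), ⟨hw, hx'X, hwx', hne'⟩, rfl⟩
  filter_upwards [hX.eventually i x hx y hy hyx _ (setOf_apply_eq_mem_nhds (n := s) rfl),
    hX.eventually i x hx z hz hzx _ (setOf_apply_eq_mem_nhds (n := s) rfl),
    hlow.filter_mono nhdsWithin_le_nhds,
    self_mem_nhdsWithin] with x' ⟨y', hy', hyx', hys⟩ ⟨z', hz', hzx', hzs⟩ hlow' hx'
  refine splitLevel_eq_of_forall hy' hz' hyx' hzx' ?_
    fun k hk w hw hwx => hlow' k (Finset.mem_range.2 hk) w hw hx' hwx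
  rw [show y' i s = y i s from hys, show z' i s = z i s from hzs]
  exact hne

lemma PreCond.eventually_mem_split {e : Bool} (hX : PreCond X) (hx : x ∈ split X i e) :
    ∀ᶠ x' in 𝓝[X] x, x' ∈ split X i e := by
  have hval : ∀ᶠ x' in 𝓝[X] x, x' i (splitLevel X i x) = e := by
    exact ((continuous_apply i).continuousAt.eventually
      (setOf_apply_eq_mem_nhds hx.2)).filter_mono nhdsWithin_le_nhds
  filter_upwards [hval, hX.eventually_splitLevel_eq i hx.1, self_mem_nhdsWithin]
    with x' hx'e hs hx'
  exact ⟨hx', hs ▸ hx'e⟩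

lemma PreCond.isClosed_split (hX : PreCond X) (i : ζ) (e : Bool) :
    IsClosed (split X i e) := by
  rw [← isOpen_compl_iff, isOpen_iff_mem_nhds]
  intro x hx
  by_cases hxX : x ∈ X
  · have hx' : x ∈ split X i (!e) := ⟨hxX, by
      have : ¬ x i (splitLevel X i x) = e := fun h => hx ⟨hxX, h⟩
      cases e <;> simp_all⟩
    filter_upwards [eventually_nhdsWithin_iff.1 (hX.eventually_mem_split hx')]
      with x' hx'e hmem
    have := (hx'e hmem.1).2
    rw [hmem.2] at this
    cases e <;> simp at this
  · filter_upwards [hX.isClosed.isOpen_compl.mem_nhds hxX] with x' hx' hmem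
    exact hx' hmem.1

lemma PreCond.preCond_split (hX : PreCond X) (i : ζ) (e : Bool) : PreCond (split X i e) := by
  have hsub := split_subset X i e
  refine ⟨hX.isClosed_split i e, ?_, ?_, ?_, ?_⟩
  · obtain ⟨x, hx⟩ := hX.nonempty
    obtain ⟨y, hy, -⟩ := hX.exists_mem_split i e hx
    exact ⟨y, hy⟩
  · intro j x hx U hU
    by_cases hij : i.1 ≤ j.1
    · rcases hij.lt_or_eq with hlt | heq
      · obtain ⟨y, hy, hyx, hyU, hne⟩ := hX.exists_ne j x hx.1 U hU
        exact ⟨y, mem_split_of_agreeOn hx hy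
          (hyx.mono fun k hk => lt_of_le_of_lt hk hlt), hyx, hyU, hne⟩
      · obtain rfl : i = j := Subtype.ext heq
        have hV : {c : Cantor | c (splitLevel X i x) = e} ∈ 𝓝 (x i) :=
          setOf_apply_eq_mem_nhds hx.2
        obtain ⟨y, hy, hyx, hyU, hne⟩ := hX.exists_ne i x hx.1 _ (inter_mem hU hV)
        refine ⟨y, ⟨hy, ?_⟩, hyx, hyU.1, hne⟩
        rw [← splitLevel_congr_point hyx]
        exact hyU.2
    · obtain ⟨y, hy, hyx, hyU, hne⟩ := hX.exists_ne j x hx.1 U hU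
      obtain ⟨w, hw, hwy⟩ := hX.exists_mem_split_agreeOn e (isLowerSet_segLe j.1) hij hy
      refine ⟨w, hw, (hwy.mono (seg_subset_segLe _)).trans hyx, ?_⟩
      rw [hwy (mem_segLe_self j.1)]
      exact ⟨hyU, hne⟩
  · intro j x hx y hy hyx G hG
    have hle : 𝓝[split X i e] x ≤ 𝓝[X] x := nhdsWithin_mono x hsub
    by_cases hij : i.1 ≤ j.1
    · rcases hij.lt_or_eq with hlt | heq
      · filter_upwards [(hX.eventually j x hx.1 y hy.1 hyx G hG).filter_mono hle,
          self_mem_nhdsWithin] with x' ⟨y', hy', hyx', hyG⟩ hx'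
        exact ⟨y', mem_split_of_agreeOn hx' hy'
          (hyx'.mono fun k hk => lt_of_le_of_lt hk hlt), hyx', hyG⟩
      · obtain rfl : i = j := Subtype.ext heq
        have hV : {c : Cantor | c (splitLevel X i x) = e} ∈ 𝓝 (y i) := by
          refine setOf_apply_eq_mem_nhds ?_
          rw [splitLevel_congr_point hyx]
          exact hy.2
        filter_upwards [(hX.eventually i x hx.1 y hy.1 hyx _ (inter_mem hG hV)).filter_mono
          hle, (hX.eventually_splitLevel_eq i hx.1).filter_mono hle]
          with x' ⟨y', hy', hyx', hyG⟩ hs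
        refine ⟨y', ⟨hy', ?_⟩, hyx', hyG.1⟩
        rw [← splitLevel_congr_point hyx', hs]
        exact hyG.2
    · filter_upwards [(hX.eventually j x hx.1 y hy.1 hyx G hG).filter_mono hle]
        with x' ⟨y', hy', hyx', hyG⟩
      obtain ⟨w, hw, hwy⟩ := hX.exists_mem_split_agreeOn e (isLowerSet_segLe j.1) hij hy'
      refine ⟨w, hw, (hwy.mono (seg_subset_segLe _)).trans hyx', ?_⟩
      rwa [hwy (mem_segLe_self j.1)]
  · intro ξ η hξ hη x hx y hy hxy
    obtain ⟨w, hw, hwx, hwy⟩ := hX.amalgamation ξ η hξ hη x hx.1 y hy.1 hxy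
    by_cases hi : i.1 ∈ ξ ∪ η
    · refine ⟨w, ?_, hwx, hwy⟩
      rcases hi with hi | hi
      · exact mem_split_of_agreeOn hx hw (hwx.mono (segLe_subset hξ hi))
      · exact mem_split_of_agreeOn hy hw (hwy.mono (segLe_subset hη hi))
    · obtain ⟨v, hv, hvw⟩ := hX.exists_mem_split_agreeOn e (hξ.union hη) hi hw
      exact ⟨v, hv, (hvw.mono Set.subset_union_left).trans hwx,
        (hvw.mono Set.subset_union_right).trans hwy⟩

lemma SameProj.sameProj_split {ξ : Set I} (h : SameProj ξ X Y) (hX : PreCond X) (hY : PreCond Y)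
    (hξ : IsLowerSet ξ) {e e' : Bool} (hee' : i.1 ∈ ξ → e = e') :
    SameProj ξ (split X i e) (split Y i e') := by
  have aux : ∀ {X Y : Set (↥ζ → Cantor)} {e e' : Bool}, SameProj ξ X Y → PreCond Y →
      (i.1 ∈ ξ → e = e') → ∀ x ∈ split X i e, ∃ y ∈ split Y i e',
        AgreeOn ξ y x := by
    intro X Y e e' h hY hee' x hx
    obtain ⟨y, hy, hyx⟩ := h.1 x hx.1
    by_cases hi : i.1 ∈ ξ
    · refine ⟨y, ⟨hy, ?_⟩, hyx⟩
      rw [hyx hi, ← splitLevel_congr hξ hi h (hyx.mono (seg_subset hξ hi)), hx.2, hee' hi]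
    · obtain ⟨w, hw, hwy⟩ := hY.exists_mem_split_agreeOn e' hξ hi hy
      exact ⟨w, hw, hwy.trans hyx⟩
  exact ⟨aux h hY hee', aux h.symm hX fun hi => (hee' hi).symm⟩

end Split

section SplitSeq

variable {Φ : ℕ → ζ} {X Y : Set (↥ζ → Cantor)} {a b : ℕ → Bool}

lemma PreCond.preCond_splitSeq (hX : PreCond X) (Φ : ℕ → ζ) (a : ℕ → Bool) (m : ℕ) :
    PreCond (splitSeq Φ X a m) := by
  induction m with
  | zero => exact hX
  | succ m ih => exact ih.preCond_split _ _

lemma splitSeq_antitone (Φ : ℕ → ζ) (X : Set (↥ζ → Cantor)) (a : ℕ → Bool) :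
    Antitone (splitSeq Φ X a) :=
  antitone_nat_of_succ_le fun _ => split_subset _ _ _

lemma splitSeq_congr {m : ℕ} (h : ∀ k < m, a k = b k) :
    splitSeq Φ X a m = splitSeq Φ X b m := by
  induction m with
  | zero => rfl
  | succ m ih => rw [splitSeq, splitSeq, ih fun k hk => h k (hk.trans m.lt_succ_self),
      h m m.lt_succ_self]

lemma eq_of_mem_splitSeq {x : ↥ζ → Cantor} {m : ℕ} (ha : x ∈ splitSeq Φ X a m)
    (hb : x ∈ splitSeq Φ X b m) : ∀ k < m, a k = b k := by
  induction m with
  | zero => simp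
  | succ m ih =>
    have hlow := ih ha.1 hb.1
    intro k hk
    rcases (Nat.lt_succ_iff.1 hk).lt_or_eq with hlt | rfl
    · exact hlow k hlt
    · have h2 := hb.2
      rw [← splitSeq_congr hlow] at h2
      exact ha.2.symm.trans h2

lemma SameProj.sameProj_splitSeq {ξ : Set I} (h : SameProj ξ X Y) (hX : PreCond X)
    (hY : PreCond Y) (hξ : IsLowerSet ξ) {m : ℕ}
    (hab : ∀ k < m, (Φ k).1 ∈ ξ → a k = b k) :
    SameProj ξ (splitSeq Φ X a m) (splitSeq Φ Y b m) := by
  induction m with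
  | zero => exact h
  | succ m ih =>
    exact (ih fun k hk => hab k (hk.trans m.lt_succ_self)).sameProj_split
      (hX.preCond_splitSeq _ _ _) (hY.preCond_splitSeq _ _ _) hξ (hab m m.lt_succ_self)

/-- The sequence `a` is the branch of the splitting of `X` along `Φ` leading to `x`. -/
def IsCode (Φ : ℕ → ζ) (X : Set (↥ζ → Cantor)) (x : ↥ζ → Cantor) (a : ℕ → Bool) : Prop :=
  ∀ m, x ∈ splitSeq Φ X a m

lemma exists_isCode {x : ↥ζ → Cantor} (Φ : ℕ → ζ) (hx : x ∈ X) : ∃ a, IsCode Φ X x a := by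
  let T : ℕ → Set (↥ζ → Cantor) :=
    Nat.rec X fun m S => split S (Φ m) (x (Φ m) (splitLevel S (Φ m) x))
  refine ⟨fun m => x (Φ m) (splitLevel (T m) (Φ m) x), fun m => ?_⟩
  have hT : ∀ m, splitSeq Φ X (fun m => x (Φ m) (splitLevel (T m) (Φ m) x)) m = T m := by
    intro m
    induction m with
    | zero => rfl
    | succ m ih => rw [splitSeq, ih]
  rw [hT]
  induction m with
  | zero => exact hx
  | succ m ih => exact ⟨ih, rfl⟩

lemma IsCode.eq {x : ↥ζ → Cantor} (ha : IsCode Φ X x a) (hb : IsCode Φ X x b) : a = b :=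
  funext fun k => eq_of_mem_splitSeq (ha (k + 1)) (hb (k + 1)) k k.lt_succ_self

lemma agreeOn_of_isCode {x y : ↥ζ → Cantor} {ξ : Set I} (hX : PreCond X) (hY : PreCond Y)
    (hξ : IsLowerSet ξ) (h : SameProj ξ X Y) (hx : IsCode Φ X x a)
    (hy : ∀ y', IsCode Φ Y y' b → y' = y) (hab : ∀ k, (Φ k).1 ∈ ξ → a k = b k) :
    AgreeOn ξ x y := by
  have hcl : ∀ m, IsClosed (splitSeq Φ Y b m ∩ {y | AgreeOn ξ y x}) := fun m =>
    (hY.preCond_splitSeq Φ b m).isClosed.inter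
      (isClosed_setOf_agreeOn continuous_id continuous_const ξ)
  obtain ⟨y', hy'⟩ := IsCompact.nonempty_iInter_of_sequence_nonempty_isCompact_isClosed
    (fun m => splitSeq Φ Y b m ∩ {y | AgreeOn ξ y x})
    (fun m => Set.inter_subset_inter_left _ (splitSeq_antitone Φ Y b m.le_succ))
    (fun m => (h.sameProj_splitSeq hX hY hξ fun k _ => hab k).1 x (hx m))
    (hcl 0).isCompact hcl
  rw [Set.mem_iInter] at hy'
  obtain rfl := hy y' fun m => (hy' m).1
  exact ((hy' 0).2 : AgreeOn ξ y' x).symm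

lemma isCode_eq_of_agreeOn {x y : ↥ζ → Cantor} {ξ : Set I} (hX : PreCond X)
    (hξ : IsLowerSet ξ) (hx : IsCode Φ X x a) (hy : IsCode Φ X y b) (hxy : AgreeOn ξ x y)
    (m : ℕ) (hm : (Φ m).1 ∈ ξ) : a m = b m := by
  induction m using Nat.strong_induction_on with
  | _ m ih =>
    have hlevel := splitLevel_congr hξ hm
      ((SameProj.refl ξ X).sameProj_splitSeq hX hX hξ ih)
      (AgreeOn.mono hxy.symm (seg_subset hξ hm))
    rw [← (hx (m + 1)).2, ← (hy (m + 1)).2, hlevel, hxy hm]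

/-- `c` assigns to each point of `X` a code that determines the point. -/
structure Coding (Φ : ℕ → ζ) (X : Set (↥ζ → Cantor)) (c : ↥X → ℕ → Bool) : Prop where
  isCode : ∀ x : ↥X, IsCode Φ X x.1 (c x)
  eq_of_isCode : ∀ (x : ↥X) (y : ↥ζ → Cantor), IsCode Φ X y (c x) → y = x.1

lemma Coding.agreeOn_iff {c : ↥X → ℕ → Bool} (hc : Coding Φ X c) (hX : PreCond X)
    {ξ : Set I} (hξ : IsLowerSet ξ) (x y : ↥X) :
    AgreeOn ξ x.1 y.1 ↔ ∀ k, (Φ k).1 ∈ ξ → c x k = c y k :=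
  ⟨fun h k hk => isCode_eq_of_agreeOn hX hξ (hc.isCode x) (hc.isCode y) h k hk,
    fun h => agreeOn_of_isCode hX hX hξ (SameProj.refl ξ X) (hc.isCode x)
      (hc.eq_of_isCode y) h⟩

lemma PreCond.exists_coding (hX : PreCond X)
    (hs : ∀ a, ∃ x, ⋂ m, splitSeq Φ X a m = {x}) :
    ∃ c : ↥X ≃ₜ (ℕ → Bool), Coding Φ X c := by
  have hs' : ∀ a, ∃ x, ∀ y, IsCode Φ X y a ↔ y = x := by
    intro a
    obtain ⟨x, hx⟩ := hs a
    refine ⟨x, fun y => ?_⟩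
    rw [← Set.mem_singleton_iff, ← hx, Set.mem_iInter, IsCode]
  choose p hp using hs'
  choose c hc using fun x : ↥X => exists_isCode Φ x.2
  have hpc : ∀ a, IsCode Φ X (p a) a := fun a => (hp a _).2 rfl
  let e : ↥X ≃ (ℕ → Bool) :=
    { toFun := c
      invFun := fun a => ⟨p a, hpc a 0⟩
      left_inv := fun x => Subtype.ext ((hp _ _).1 (hc x)).symm
      right_inv := fun a => (hc _).eq (hpc a) }
  have hcont : Continuous e := by
    refine continuous_pi fun k => continuous_iff_continuousAt.2 fun x => ?_
    have hmem : ∀ m, ∀ᶠ x' in 𝓝[X] x.1, x' ∈ splitSeq Φ X (c x) m := by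
      intro m
      induction m with
      | zero => exact self_mem_nhdsWithin
      | succ m ih =>
        have := (hX.preCond_splitSeq Φ (c x) m).eventually_mem_split (hc x (m + 1))
        filter_upwards [ih, eventually_nhdsWithin_iff.1 this |>.filter_mono
          nhdsWithin_le_nhds] with x' h1 h2
        exact h2 h1
    have hev : ∀ᶠ x' : ↥X in 𝓝 x, c x' k = c x k := by
      have := hmem (k + 1)
      rw [nhdsWithin_eq_map_subtype_coe x.2, Filter.eventually_map] at this
      filter_upwards [this] with x' hx'
      exact eq_of_mem_splitSeq (hc x' (k + 1)) hx' k k.lt_succ_self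
    exact continuousAt_const.congr (hev.mono fun _ h => h.symm)
  have : CompactSpace ↥X := isCompact_iff_compactSpace.1 hX.isClosed.isCompact
  exact ⟨hcont.homeoOfEquivCompactToT2, hc, fun x y hy =>
    ((hp _ _).1 hy).trans ((hp _ _).1 (hc x)).symm⟩

/-- The splitting level of a smaller pre-condition is recognized by the codes. -/
lemma Coding.exists_isLeast {c : ↥X → ℕ → Bool} (hc : Coding Φ X c) (hX : PreCond X)
    {X' : Set (↥ζ → Cantor)} (hX' : PreCond X') (hsub : X' ⊆ X) (i : ζ) (x : ↥X)
    (hx : x.1 ∈ X') :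
    ∃ m, IsLeast {m | Φ m = i ∧ ∃ y z : ↥X, y.1 ∈ X' ∧ z.1 ∈ X' ∧
        AgreeOn (seg i.1) y.1 x.1 ∧ AgreeOn (seg i.1) z.1 x.1 ∧ c y m ≠ c z m} m ∧
      x.1 i (splitLevel X' i x.1) = c x m := by
  classical
  have hex : ∃ m, Φ m = i ∧ ∃ y z : ↥X, y.1 ∈ X' ∧ z.1 ∈ X' ∧
      AgreeOn (seg i.1) y.1 x.1 ∧ AgreeOn (seg i.1) z.1 x.1 ∧ c y m ≠ c z m := by
    obtain ⟨y, hy, hyx, -, hne⟩ := hX'.exists_ne i x.1 hx Set.univ univ_mem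
    have hle : ¬ AgreeOn (segLe i.1) y x.1 := fun h => hne (h (mem_segLe_self i.1))
    rw [hc.agreeOn_iff hX (isLowerSet_segLe _) ⟨y, hsub hy⟩ x] at hle
    push Not at hle
    obtain ⟨m, hm, hne'⟩ := hle
    have hlt := (hc.agreeOn_iff hX (isLowerSet_seg _) ⟨y, hsub hy⟩ x).1 hyx m
    refine ⟨m, Subtype.ext ?_, ⟨y, hsub hy⟩, x, hy, hx, hyx, fun _ _ => rfl, hne'⟩
    by_contra h
    exact hne' (hlt (lt_of_le_of_ne hm h))
  have hleast := Nat.find_spec hex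
  have hmin := fun k hk => Nat.find_min (m := k) hex hk
  refine ⟨Nat.find hex, ⟨hleast, fun k hk => Nat.find_min' hex hk⟩, ?_⟩
  generalize Nat.find hex = m at hleast hmin
  obtain ⟨hm, y, z, hy, hz, hyx, hzx, hne⟩ := hleast
  have hproj : ∀ w : ↥X, w.1 ∈ X' → AgreeOn (seg i.1) w.1 x.1 →
      SameProj (segLe i.1) (splitSeq Φ X (c w) m) (splitSeq Φ X (c x) m) := by
    intro w hw hwx
    refine (SameProj.refl _ X).sameProj_splitSeq hX hX (isLowerSet_segLe _) ?_
    intro k hk hki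
    by_contra hne'
    rcases (hki : (Φ k).1 ≤ i.1).lt_or_eq with hlt | heq
    · exact hne' ((hc.agreeOn_iff hX (isLowerSet_seg _) w x).1 hwx k hlt)
    · exact hmin k hk ⟨Subtype.ext heq, w, x, hw, hx, hwx, fun _ _ => rfl, hne'⟩
  set s := splitLevel (splitSeq Φ X (c x) m) i x.1 with hs
  have hval : ∀ w : ↥X, w.1 ∈ X' → AgreeOn (seg i.1) w.1 x.1 → w.1 i s = c w m := by
    intro w hw hwx
    have h := (hc.isCode w (m + 1)).2
    rw [hm] at h
    rwa [hs, ← splitLevel_congr (isLowerSet_segLe _) (mem_segLe_self i.1)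
      (hproj w hw hwx) hwx.symm]
  have hlevel : splitLevel X' i x.1 = s := by
    refine splitLevel_eq_of_forall hy hz hyx hzx ?_ ?_
    · rwa [hval y hy hyx, hval z hz hzx]
    · intro k hk w hw hwx
      obtain ⟨v, hv, hvw⟩ := (hproj ⟨w, hsub hw⟩ hw hwx).1 w (hc.isCode ⟨w, hsub hw⟩ m)
      rw [← hvw (mem_segLe_self i.1)]
      exact eq_of_lt_splitLevel hk hv (hc.isCode x m)
        ((hvw.mono (seg_subset_segLe _)).trans hwx) fun _ _ => rfl
  rw [hlevel]
  exact hval x hx fun _ _ => rfl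

end SplitSeq

section Transfer

variable {X Y : Set (↥ζ → Cantor)}

/-- `F` respects projections to initial segments in both directions. -/
def PreservesAgree (F : ↥X ≃ₜ ↥Y) : Prop :=
  ∀ ξ : Set I, IsLowerSet ξ → ∀ x y : ↥X,
    AgreeOn ξ x.1 y.1 ↔ AgreeOn ξ (F x).1 (F y).1

lemma PreservesAgree.exists_nhds {F : ↥X ≃ₜ ↥Y} (hF : PreservesAgree F) (hX : IsClosed X)
    (i : ζ) (x : ↥X) {G : Set Cantor} (hG : G ∈ 𝓝 ((F x).1 i)) :
    ∃ U ∈ 𝓝 (restrictFn (ξ := ζ ∩ seg i.1) Set.inter_subset_left x.1), ∃ V ∈ 𝓝 (x.1 i),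
      ∀ y : ↥X, restrictFn (ξ := ζ ∩ seg i.1) Set.inter_subset_left y.1 ∈ U →
        y.1 i ∈ V → (F y).1 i ∈ G := by
  obtain ⟨G', hG'G, hG', hxG'⟩ := mem_nhds_iff.1 hG
  have : CompactSpace ↥X := isCompact_iff_compactSpace.1 hX.isCompact
  let r : ↥X → (↥(ζ ∩ seg i.1) → Cantor) × Cantor := fun y =>
    (restrictFn (ξ := ζ ∩ seg i.1) Set.inter_subset_left y.1, y.1 i)
  have hr : Continuous r :=
    ((continuous_restrictFn _).comp continuous_subtype_val).prodMk
      ((continuous_apply i).comp continuous_subtype_val)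
  have hK : IsClosed {y : ↥X | (F y).1 i ∉ G'} :=
    hG'.isClosed_compl.preimage
      ((continuous_apply i).comp (continuous_subtype_val.comp F.continuous))
  have hx : r x ∈ (r '' {y : ↥X | (F y).1 i ∉ G'})ᶜ := by
    rintro ⟨y, hy, hyx⟩
    have hagree : AgreeOn (segLe i.1) y.1 x.1 := by
      intro j hj
      rcases (hj : j.1 ≤ i.1).lt_or_eq with hlt | heq
      · exact congrFun (congrArg Prod.fst hyx) ⟨j.1, j.2, hlt⟩
      · obtain rfl : j = i := Subtype.ext heq
        exact congrArg Prod.snd hyx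
    apply hy
    rw [(hF _ (isLowerSet_segLe _) y x).1 hagree (mem_segLe_self i.1)]
    exact hxG'
  obtain ⟨U, hU, V, hV, hUV⟩ := mem_nhds_prod_iff.1
    ((hK.isCompact.image hr).isClosed.isOpen_compl.mem_nhds hx)
  refine ⟨U, hU, V, hV, fun y hyU hyV => hG'G ?_⟩
  by_contra hy
  exact hUV (Set.mk_mem_prod hyU hyV) ⟨y, hy, rfl⟩

lemma PreservesAgree.preCond_imageOn {F : ↥X ≃ₜ ↥Y} (hF : PreservesAgree F)
    (hX : IsClosed X) {X' : Set (↥ζ → Cantor)} (hX' : PreCond X') (hsub : X' ⊆ X) :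
    PreCond (imageOn F X') := by
  refine ⟨?_, ?_, ?_, ?_, ?_⟩
  · have : CompactSpace ↥X := isCompact_iff_compactSpace.1 hX.isCompact
    have hK : IsCompact {x : ↥X | x.1 ∈ X'} :=
      (hX'.isClosed.preimage continuous_subtype_val).isCompact
    exact (hK.image (continuous_subtype_val.comp F.continuous)).isClosed
  · obtain ⟨x, hx⟩ := hX'.nonempty
    exact ⟨_, ⟨x, hsub hx⟩, hx, rfl⟩
  · rintro i _ ⟨x, hx, rfl⟩ G hG
    obtain ⟨U, hU, V, hV, hUV⟩ := hF.exists_nhds hX i x hG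
    obtain ⟨y, hy, hyx, hyV, hne⟩ := hX'.exists_ne i x.1 hx V hV
    refine ⟨_, ⟨⟨y, hsub hy⟩, hy, rfl⟩, (hF _ (isLowerSet_seg _) ⟨y, hsub hy⟩ x).1 hyx,
      hUV ⟨y, hsub hy⟩ ?_ hyV, ?_⟩
    · rw [(restrictFn_eq_iff_agreeOn _).2 (hyx.mono Set.inter_subset_right)]
      exact mem_of_mem_nhds hU
    · intro heq
      refine hne ((hF _ (isLowerSet_segLe i.1) ⟨y, hsub hy⟩ x).2 ?_ (mem_segLe_self i.1))
      intro j hj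
      rcases (hj : j.1 ≤ i.1).lt_or_eq with hlt | hji
      · exact (hF _ (isLowerSet_seg _) ⟨y, hsub hy⟩ x).1 hyx hlt
      · obtain rfl : j = i := Subtype.ext hji
        exact heq
  · rintro i _ ⟨x, hx, rfl⟩ _ ⟨y, hy, rfl⟩ hyx G hG
    rw [← hF _ (isLowerSet_seg _)] at hyx
    obtain ⟨U, hU, V, hV, hUV⟩ := hF.exists_nhds hX i y hG
    rw [(restrictFn_eq_iff_agreeOn _).2 (hyx.mono Set.inter_subset_right)] at hU
    have hU' : ∀ᶠ x' in 𝓝[X'] x.1,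
        restrictFn (ξ := ζ ∩ seg i.1) Set.inter_subset_left x' ∈ U :=
      ((continuous_restrictFn _).continuousAt.eventually hU).filter_mono nhdsWithin_le_nhds
    have hev : ∀ᶠ x' in 𝓝 x.1, x' ∈ X' →
        ∃ y' ∈ X', AgreeOn (seg i.1) y' x' ∧ y' i ∈ V ∧
          restrictFn (ξ := ζ ∩ seg i.1) Set.inter_subset_left y' ∈ U := by
      rw [← eventually_nhdsWithin_iff]
      filter_upwards [hU', hX'.eventually i x.1 hx y.1 hy hyx V hV]
        with x' hx'U ⟨y', hy', hyx', hyV⟩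
      refine ⟨y', hy', hyx', hyV, ?_⟩
      rwa [(restrictFn_eq_iff_agreeOn _).2 (hyx'.mono Set.inter_subset_right)]
    have hcont : ContinuousAt (fun y : ↥Y => (F.symm y).1) (F x) :=
      (continuous_subtype_val.comp F.symm.continuous).continuousAt
    have hev' : ∀ᶠ y in 𝓝[Y] (F x).1, ∀ hy : y ∈ Y, (F.symm ⟨y, hy⟩).1 ∈ X' →
        ∃ y' ∈ X', AgreeOn (seg i.1) y' (F.symm ⟨y, hy⟩).1 ∧ y' i ∈ V ∧
          restrictFn (ξ := ζ ∩ seg i.1) Set.inter_subset_left y' ∈ U := by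
      rw [nhdsWithin_eq_map_subtype_coe (F x).2, Filter.eventually_map]
      have := hcont.eventually (p := fun x' => x' ∈ X' → ∃ y' ∈ X',
        AgreeOn (seg i.1) y' x' ∧ y' i ∈ V ∧
          restrictFn (ξ := ζ ∩ seg i.1) Set.inter_subset_left y' ∈ U) (by simpa using hev)
      exact this.mono fun _ h _ => h
    filter_upwards [hev'.filter_mono (nhdsWithin_mono _ (imageOn_subset F X')),
      self_mem_nhdsWithin]
    rintro _ h ⟨x', hx', rfl⟩
    obtain ⟨y', hy', hyx', hyV, hyU⟩ := h (F x').2 (by simpa using hx')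
    have hyx'' : AgreeOn (seg i.1) y' x'.1 := by simpa using hyx'
    exact ⟨_, ⟨⟨y', hsub hy'⟩, hy', rfl⟩, (hF _ (isLowerSet_seg _) ⟨y', hsub hy'⟩ x').1 hyx'',
      hUV ⟨y', hsub hy'⟩ hyU hyV⟩
  · rintro ξ η hξ hη _ ⟨x, hx, rfl⟩ _ ⟨y, hy, rfl⟩ hxy
    rw [← hF _ (hξ.inter hη)] at hxy
    obtain ⟨w, hw, hwx, hwy⟩ := hX'.amalgamation ξ η hξ hη x.1 hx y.1 hy hxy
    exact ⟨_, ⟨⟨w, hsub hw⟩, hw, rfl⟩, (hF _ hξ ⟨w, hsub hw⟩ x).1 hwx,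
      (hF _ hη ⟨w, hsub hw⟩ y).1 hwy⟩

variable {Φ : ℕ → ζ} {c : ↥X → ℕ → Bool} {d : ↥Y → ℕ → Bool}

lemma Coding.preservesAgree (hc : Coding Φ X c) (hd : Coding Φ Y d) (hX : PreCond X)
    (hY : PreCond Y) {F : ↥X ≃ₜ ↥Y} (hF : ∀ x, d (F x) = c x) : PreservesAgree F := by
  intro ξ hξ x y
  rw [hc.agreeOn_iff hX hξ, hd.agreeOn_iff hY hξ, hF, hF]

lemma Coding.imageOn_split (hc : Coding Φ X c) (hd : Coding Φ Y d) (hX : PreCond X)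
    (hY : PreCond Y) {F : ↥X ≃ₜ ↥Y} (hF : ∀ x, d (F x) = c x) {X' : Set (↥ζ → Cantor)}
    (hX' : PreCond X') (hsub : X' ⊆ X) (i : ζ) (e : Bool) :
    imageOn F (split X' i e) = split (imageOn F X') i e := by
  have hagree := hc.preservesAgree hd hX hY hF
  have hval : ∀ x : ↥X, x.1 ∈ X' → x.1 i (splitLevel X' i x.1) =
      (F x).1 i (splitLevel (imageOn F X') i (F x).1) := by
    intro x hx
    obtain ⟨m, hm, hxm⟩ := hc.exists_isLeast hX hX' hsub i x hx
    obtain ⟨n, hn, hxn⟩ := hd.exists_isLeast hY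
      (hagree.preCond_imageOn hX.isClosed hX' hsub) (imageOn_subset F X') i (F x)
      (mem_imageOn.2 hx)
    have hmn : m = n := by
      refine hm.unique ((congrArg (IsLeast · n) ?_).mpr hn)
      ext k
      simp only [Set.mem_ofPred_eq, F.surjective.exists, mem_imageOn, hF,
        ← hagree _ (isLowerSet_seg _)]
    rw [hxm, hxn, hmn, hF]
  ext y
  constructor
  · rintro ⟨x, ⟨hx, hxe⟩, rfl⟩
    exact ⟨mem_imageOn.2 hx, (hval x hx).symm.trans hxe⟩
  · rintro ⟨⟨x, hx, rfl⟩, hxe⟩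
    exact ⟨x, ⟨hx, (hval x hx).trans hxe⟩, rfl⟩

lemma Coding.imageOn_splitSeq (hc : Coding Φ X c) (hd : Coding Φ Y d) (hX : PreCond X)
    (hY : PreCond Y) {F : ↥X ≃ₜ ↥Y} (hF : ∀ x, d (F x) = c x) {X' : Set (↥ζ → Cantor)}
    (hX' : PreCond X') (hsub : X' ⊆ X) (Ψ : ℕ → ζ) (a : ℕ → Bool) (m : ℕ) :
    imageOn F (splitSeq Ψ X' a m) = splitSeq Ψ (imageOn F X') a m := by
  induction m with
  | zero => rfl
  | succ m ih =>
    rw [splitSeq, splitSeq, ← ih]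
    exact hc.imageOn_split hd hX hY hF (hX'.preCond_splitSeq Ψ a m)
      ((splitSeq_antitone Ψ X' a (Nat.zero_le m)).trans hsub) _ _

lemma Coding.pe_imageOn (hc : Coding Φ X c) (hd : Coding Φ Y d) (hX : PreCond X)
    (hY : PreCond Y) {F : ↥X ≃ₜ ↥Y} (hF : ∀ x, d (F x) = c x) (hζ : IsLowerSet ζ)
    {X' : Set (↥ζ → Cantor)} (hX' : Pe ζ hζ X') (hsub : X' ⊆ X) :
    Pe ζ hζ (imageOn F X') := by
  have hpre := hX'.1.preCond
  refine ⟨((hc.preservesAgree hd hX hY hF).preCond_imageOn hX.isClosed hpre hsub).iPe hζ, ?_⟩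
  intro Ψ hΨ a
  obtain ⟨x, hx⟩ := hX'.2 Ψ hΨ a
  simp only [XPhi_eq_splitSeq, ← hc.imageOn_splitSeq hd hX hY hF hpre hsub] at hx ⊢
  have hx' : ∀ x', (∀ m, x' ∈ splitSeq (fun n => ⟨Ψ n, hΨ.1 n⟩) X' a m) ↔ x' = x := by
    intro x'
    rw [← Set.mem_iInter, hx, Set.mem_singleton_iff]
  have hxX : x ∈ X := hsub ((hx' x).2 rfl 0)
  refine ⟨(F ⟨x, hxX⟩).1, Set.Subset.antisymm ?_ ?_⟩
  · intro y hy
    rw [Set.mem_iInter] at hy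
    obtain ⟨x', -, rfl⟩ := hy 0
    obtain rfl := (hx' x'.1).1 fun m => mem_imageOn.1 (hy m)
    rfl
  · rintro _ rfl
    exact Set.mem_iInter.2 fun m => mem_imageOn.2 ((hx' x).2 rfl m)

end Transfer

end Homogeneity

theorem stmt12 (I : Type) [PartialOrder I] [Countable I]
    (ζ : Set I) (hζ : IsLowerSet ζ)
    (X Y : Set (↥ζ → Cantor)) (hX : Pe ζ hζ X) (hY : Pe ζ hζ Y) :
    ∃ F : ↥X ≃ₜ ↥Y,
      (∀ (ξ : Set I), IsLowerSet ξ → ∀ (hsub : ξ ⊆ ζ), ∀ x y : ↥X,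
        (restrictFn hsub x.1 = restrictFn hsub y.1 ↔
          restrictFn hsub (F x).1 = restrictFn hsub (F y).1)) ∧
      (∀ (ξ : Set I), IsLowerSet ξ → ∀ (hsub : ξ ⊆ ζ),
        resSet hsub X = resSet hsub Y →
          ∀ x : ↥X, restrictFn hsub x.1 = restrictFn hsub (F x).1) ∧
      (∀ X' : Set (↥ζ → Cantor), X' ⊆ X →
        (Pe ζ hζ X' ↔ Pe ζ hζ {y | ∃ x : ↥X, x.1 ∈ X' ∧ (F x).1 = y})) := by
  rcases ζ.eq_empty_or_nonempty with rfl | hne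
  · have huniv : ∀ {Z : Set (↥(∅ : Set I) → Cantor)}, Pe ∅ hζ Z → Z = Set.univ := fun h =>
      h.1.1.2.eq_univ
    obtain rfl : X = Y := (huniv hX).trans (huniv hY).symm
    refine ⟨Homeomorph.refl _, fun ξ _ hsub x y => Iff.rfl, fun ξ _ hsub _ x => rfl,
      fun X' hX' => ?_⟩
    convert Iff.rfl using 2
    ext y
    exact ⟨fun ⟨x, hx, hxy⟩ => hxy ▸ hx, fun hy => ⟨⟨y, hX' hy⟩, hy, rfl⟩⟩
  obtain ⟨Φ, hΦ⟩ := exists_admissible hne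
  have hpX := hX.1.preCond
  have hpY := hY.1.preCond
  obtain ⟨c, hc⟩ := hpX.exists_coding (Φ := fun n => ⟨Φ n, hΦ.1 n⟩) fun a => by
    simpa only [XPhi_eq_splitSeq] using hX.2 Φ hΦ a
  obtain ⟨d, hd⟩ := hpY.exists_coding (Φ := fun n => ⟨Φ n, hΦ.1 n⟩) fun a => by
    simpa only [XPhi_eq_splitSeq] using hY.2 Φ hΦ a
  have hF : ∀ x, d ((c.trans d.symm) x) = c x := fun x => by simp
  have hF' : ∀ y, c ((c.trans d.symm).symm y) = d y := fun y => by simp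
  refine ⟨c.trans d.symm, fun ξ hξ hsub x y => ?_, fun ξ hξ hsub h x => ?_,
    fun X' hX' => ⟨fun h => hc.pe_imageOn hd hpX hpY hF hζ h hX', fun h => ?_⟩⟩
  · rw [restrictFn_eq_iff_agreeOn, restrictFn_eq_iff_agreeOn]
    exact hc.preservesAgree hd hpX hpY hF ξ hξ x y
  · rw [restrictFn_eq_iff_agreeOn]
    exact agreeOn_of_isCode hpX hpY hξ (SameProj.of_resSet_eq hsub h) (hc.isCode x)
      (hd.eq_of_isCode _) fun k _ => by rw [hF]
  · have := hd.pe_imageOn hc hpY hpX hF' hζ h (imageOn_subset _ X')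
    rwa [show {y | ∃ x : ↥X, x.1 ∈ X' ∧ ((c.trans d.symm) x).1 = y} =
      imageOn (c.trans d.symm) X' from rfl, imageOn_symm_imageOn _ hX'] at this
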